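/- arXiv:1301.2137 — 2 statements merged into one kernel-verified Lean document; each statement's English description precedes it below -/
import Mathlib

section
/- Let Φ = (φ_1,…,φ_n) be a finite list of nonempty KBs, μ a set of interpretations, p a variable and b : Bool. Suppose there is a nonempty subfamily Φ' of Φ such that every φ' ∈ Φ' satisfies φ' ⊆ {ω | ω p = b}, every member of Φ not in Φ' is independent of p, μ is independent of p, and μ ∩ {ω | ω p = b} ≠ ∅. Then Δ^{f2}_μ(Φ) ⊆ {ω | ω p = b} ∩ μ (property A1 for Δ^{f2}). -/
/-- Hamming (Dalal) distance between two interpretations. -/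
def hdist {P : Type*} [Fintype P] [DecidableEq P] (ω ω' : P → Bool) : ℕ :=
  (Finset.univ.filter fun p => ω p ≠ ω' p).card

/-- Distance from an interpretation to a knowledge base (set of models). -/
noncomputable def distToKB {P : Type*} [Fintype P] [DecidableEq P]
    (ω : P → Bool) (φ : Set (P → Bool)) : ℕ :=
  sInf (hdist ω '' φ)

/-- Forgetting a set of variables `V` in a knowledge base `φ`. -/
def forget {P : Type*} [Fintype P] [DecidableEq P]
    (V : Finset P) (φ : Set (P → Bool)) : Set (P → Bool) :=
  {ω | ∃ ω' ∈ φ, ∀ p ∉ V, ω p = ω' p}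

/-- `FS2 Φ μ`: sets of variables minimal w.r.t. set inclusion whose forgetting makes the
intersection of the KBs with μ consistent. -/
def FS2 {P : Type*} [Fintype P] [DecidableEq P] {n : ℕ}
    (Φ : Fin n → Set (P → Bool)) (μ : Set (P → Bool)) : Set (Finset P) :=
  {V | ((⋂ i, forget V (Φ i)) ∩ μ).Nonempty ∧
    ∀ W : Finset P, W ⊆ V → ((⋂ i, forget W (Φ i)) ∩ μ).Nonempty → W = V}

/-- The merging operator Δ^{f2}. -/
def deltaF2 {P : Type*} [Fintype P] [DecidableEq P] {n : ℕ}
    (μ : Set (P → Bool)) (Φ : Fin n → Set (P → Bool)) : Set (P → Bool) :=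
  ⋃ V ∈ FS2 Φ μ, ((⋂ i, forget V (Φ i)) ∩ μ)

/-- A set of interpretations is independent of the variable `p` iff it is closed under
switching the truth value of `p`. -/
def indepOf {P : Type*} [Fintype P] [DecidableEq P]
    (p : P) (S : Set (P → Bool)) : Prop :=
  ∀ ω ∈ S, Function.update ω p (!ω p) ∈ S

theorem indepOf.update_mem {P : Type*} [Fintype P] [DecidableEq P] {p : P}
    {T : Set (P → Bool)} (hT : indepOf p T) {ω : P → Bool} (hω : ω ∈ T) (b : Bool) :
    Function.update ω p b ∈ T := by
  by_cases h : ω p = b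
  · rwa [← h, Function.update_eq_self]
  · have hb : b = !ω p := by cases b <;> simp_all
    rw [hb]
    exact hT ω hω

theorem update_mem_forget_erase {P : Type*} [Fintype P] [DecidableEq P] {V : Finset P} {p : P}
    {φ : Set (P → Bool)} {b : Bool} (hφ : φ ⊆ {ω | ω p = b} ∨ indepOf p φ)
    {ω : P → Bool} (hω : ω ∈ forget V φ) :
    Function.update ω p b ∈ forget (V.erase p) φ := by
  obtain ⟨ω', hω', hag⟩ := hω
  refine ⟨Function.update ω' p b, ?_, fun q hq => ?_⟩
  · rcases hφ with hφ | hφ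
    · have hb : ω' p = b := hφ hω'
      rwa [← hb, Function.update_eq_self]
    · exact hφ.update_mem hω' b
  · by_cases hqp : q = p
    · subst hqp
      simp
    · simpa [hqp] using hag q fun hV => hq (Finset.mem_erase.2 ⟨hqp, hV⟩)

theorem deltaF2_A1
    {P : Type*} [Fintype P] [DecidableEq P] {n : ℕ}
    (Φ : Fin n → Set (P → Bool)) (hΦ : ∀ i, (Φ i).Nonempty)
    (μ : Set (P → Bool)) (p : P) (b : Bool)
    (S : Finset (Fin n)) (hS : S.Nonempty)
    (hent : ∀ i ∈ S, Φ i ⊆ {ω | ω p = b})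
    (hrest : ∀ i ∉ S, indepOf p (Φ i))
    (hμ : indepOf p μ)
    (hμp : (μ ∩ {ω | ω p = b}).Nonempty) :
    deltaF2 μ Φ ⊆ {ω | ω p = b} ∩ μ := by
  intro ω hω
  simp only [deltaF2, Set.mem_iUnion] at hω
  obtain ⟨V, ⟨-, hmin⟩, hωV, hωμ⟩ := hω
  rw [Set.mem_iInter] at hωV
  have hpV : p ∉ V := by
    refine Finset.erase_eq_self.1 (hmin _ (V.erase_subset p)
      ⟨Function.update ω p b, Set.mem_iInter.2 fun i => ?_, hμ.update_mem hωμ b⟩)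
    refine update_mem_forget_erase ?_ (hωV i)
    by_cases hi : i ∈ S
    · exact Or.inl (hent i hi)
    · exact Or.inr (hrest i hi)
  obtain ⟨i, hi⟩ := hS
  obtain ⟨ω', hω', hag⟩ := hωV i
  exact ⟨(hag p hpV).trans (hent i hi hω'), hωμ⟩
end

section
/- Let Φ = (φ_1,…,φ_n) be a finite list of nonempty KBs, μ a nonempty set of interpretations, p a variable and b : Bool. Suppose some φ_i ⊆ {ω | ω p = b}, some φ_j ⊆ {ω | ω p ≠ b}, and μ is independent of p. Then Δ^{f2}_μ(Φ) entails neither the literal (p,b) nor its negation: there exist ω, ω' ∈ Δ^{f2}_μ(Φ) with ω p = b and ω' p ≠ b (property A2 for Δ^{f2}). -/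
theorem forget_univ {P : Type*} [Fintype P] [DecidableEq P] {φ : Set (P → Bool)}
    (h : φ.Nonempty) : forget Finset.univ φ = Set.univ := by
  obtain ⟨ω', hω'⟩ := h
  exact Set.eq_univ_of_forall fun _ => ⟨ω', hω', fun p hp => absurd (Finset.mem_univ p) hp⟩

theorem indepOf_forget {P : Type*} [Fintype P] [DecidableEq P] {V : Finset P} {p : P}
    (hp : p ∈ V) (φ : Set (P → Bool)) : indepOf p (forget V φ) := by
  rintro ω ⟨ω', hω', h⟩
  refine ⟨ω', hω', fun q hq => ?_⟩
  rw [Function.update_of_ne (ne_of_mem_of_not_mem hp hq).symm]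
  exact h q hq

theorem FS2_nonempty {P : Type*} [Fintype P] [DecidableEq P] {n : ℕ}
    {Φ : Fin n → Set (P → Bool)} (hΦ : ∀ i, (Φ i).Nonempty)
    {μ : Set (P → Bool)} (hμ : μ.Nonempty) : (FS2 Φ μ).Nonempty := by
  have huniv : ((⋂ i, forget Finset.univ (Φ i)) ∩ μ).Nonempty := by
    simpa [forget_univ (hΦ _)] using hμ
  obtain ⟨V, -, hV⟩ := exists_minimal_le_of_wellFoundedLT
    (fun V : Finset P => ((⋂ i, forget V (Φ i)) ∩ μ).Nonempty) Finset.univ huniv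
  exact ⟨V, hV.prop, fun W hWV hW => hWV.antisymm (hV.le_of_le hW hWV)⟩

theorem deltaF2_A2
    {P : Type*} [Fintype P] [DecidableEq P] {n : ℕ}
    (Φ : Fin n → Set (P → Bool)) (hΦ : ∀ i, (Φ i).Nonempty)
    (μ : Set (P → Bool)) (hμne : μ.Nonempty) (p : P) (b : Bool) (i j : Fin n)
    (hi : Φ i ⊆ {ω | ω p = b}) (hj : Φ j ⊆ {ω | ω p ≠ b})
    (hμ : indepOf p μ) :
    (∃ ω ∈ deltaF2 μ Φ, ω p = b) ∧ (∃ ω' ∈ deltaF2 μ Φ, ω' p ≠ b) := by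
  obtain ⟨V, hV⟩ := FS2_nonempty hΦ hμne
  obtain ⟨ω, hω, hωμ⟩ := hV.1
  have hωV : ∀ k, ω ∈ forget V (Φ k) := Set.mem_iInter.1 hω
  have hpV : p ∈ V := by
    by_contra hp
    obtain ⟨ω₁, h₁, e₁⟩ := hωV i
    obtain ⟨ω₂, h₂, e₂⟩ := hωV j
    exact hj h₂ ((e₂ p hp).symm.trans ((e₁ p hp).trans (hi h₁)))
  have hmem : ω ∈ deltaF2 μ Φ := Set.mem_biUnion hV ⟨hω, hωμ⟩
  have hflip : Function.update ω p (!ω p) ∈ deltaF2 μ Φ :=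
    Set.mem_biUnion hV
      ⟨Set.mem_iInter.2 fun k => indepOf_forget hpV (Φ k) ω (hωV k), hμ ω hωμ⟩
  by_cases hb : ω p = b
  · exact ⟨⟨ω, hmem, hb⟩, _, hflip, by simp [hb]⟩
  · exact ⟨⟨_, hflip, by simpa using Bool.eq_not.2 hb⟩, ω, hmem, hb⟩
end
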